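/- Let d ≥ 1, let A be an invertible real d×d matrix with |det A| = 1, B = (A⁻¹)ᵀ, and let f ∈ 𝓕. Suppose z₀ ∈ ℝ^d satisfies: for every α > 0 and every z ∈ ℝ^d, ∑_{n∈ℤ^d} exp(−πα|Bn + z₀|²) ≤ ∑_{n∈ℤ^d} exp(−πα|Bn + z|²); suppose z₀ ∉ Bℤ^d and Nz₀ ∈ Bℤ^d for some integer N ≥ 2. Then there exists c > 0 such that φ*(m) := c·cos(2π (Am)·z₀) is N-periodic, satisfies the normalization and the charge neutrality constraint, its Ewald energy E_{X,f}[φ*] exists, and for every integer M ≥ 1 and every M-periodic ψ : ℤ^d → ℝ satisfying the normalization and the charge neutrality constraint, the Ewald energy E_{X,f}[ψ] exists and E_{X,f}[φ*] ≤ E_{X,f}[ψ]. -/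

import Mathlib

open scoped Real BigOperators Topology
open MeasureTheory Filter

/-- The squared Euclidean norm on `ℝ^d`. -/
noncomputable def sqNorm {d : ℕ} (x : Fin d → ℝ) : ℝ := ∑ i, x i ^ 2

/-- The inclusion of `ℤ^d` in `ℝ^d`. -/
def intVec {d : ℕ} (m : Fin d → ℤ) : Fin d → ℝ := fun j => (m j : ℝ)

section Quadratic

variable {d : ℕ}

theorem sqNorm_nonneg (x : Fin d → ℝ) : 0 ≤ sqNorm x :=
  Finset.sum_nonneg fun _ _ => sq_nonneg _

theorem continuous_sqNorm : Continuous (sqNorm : (Fin d → ℝ) → ℝ) := by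
  unfold sqNorm; fun_prop

theorem intVec_add (m n : Fin d → ℤ) : intVec (m + n) = intVec m + intVec n := by
  ext i; simp [intVec]

theorem one_le_sqNorm_intVec {m : Fin d → ℤ} (hm : m ≠ 0) : 1 ≤ sqNorm (intVec m) := by
  obtain ⟨i, hi⟩ := Function.ne_iff.mp hm
  have h1 : (1 : ℝ) ≤ (m i : ℝ) ^ 2 := by
    have : (1 : ℤ) ≤ m i ^ 2 := by
      have := sq_pos_of_ne_zero (a := m i) (by simpa using hi)
      omega
    exact_mod_cast this
  exact h1.trans (Finset.single_le_sum (f := fun i => intVec m i ^ 2)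
    (fun i _ => sq_nonneg _) (Finset.mem_univ i))

theorem exists_sqNorm_mulVec_le (M : Matrix (Fin d) (Fin d) ℝ) :
    ∃ C : ℝ, 0 < C ∧ ∀ x, sqNorm (M.mulVec x) ≤ C * sqNorm x := by
  refine ⟨∑ i, ∑ j, M i j ^ 2 + 1, by positivity, fun x => ?_⟩
  have h : sqNorm (M.mulVec x) ≤ (∑ i, ∑ j, M i j ^ 2) * sqNorm x := by
    unfold sqNorm
    rw [Finset.sum_mul]
    refine Finset.sum_le_sum fun i _ => ?_
    exact Finset.sum_mul_sq_le_sq_mul_sq Finset.univ (fun j => M i j) x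
  nlinarith [sqNorm_nonneg x]

theorem exists_le_sqNorm_mulVec {M M' : Matrix (Fin d) (Fin d) ℝ} (h : M' * M = 1) :
    ∃ κ : ℝ, 0 < κ ∧ ∀ x, κ * sqNorm x ≤ sqNorm (M.mulVec x) := by
  obtain ⟨C, hC, hM⟩ := exists_sqNorm_mulVec_le M'
  refine ⟨C⁻¹, by positivity, fun x => ?_⟩
  have := hM (M.mulVec x)
  rw [Matrix.mulVec_mulVec, h, Matrix.one_mulVec] at this
  rw [inv_mul_le_iff₀ hC]
  exact this

theorem sqNorm_le_two_mul_add (x y : Fin d → ℝ) :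
    sqNorm x ≤ 2 * (sqNorm (x + y) + sqNorm y) := by
  unfold sqNorm
  rw [← Finset.sum_add_distrib, Finset.mul_sum]
  refine Finset.sum_le_sum fun i _ => ?_
  simp only [Pi.add_apply]
  nlinarith [sq_nonneg (x i + 2 * y i)]

theorem summable_exp_neg_mul_int_sq {c : ℝ} (hc : 0 < c) :
    Summable fun n : ℤ => Real.exp (-(c * (n : ℝ) ^ 2)) := by
  have hn : Summable fun n : ℕ => Real.exp (-(c * (n : ℝ) ^ 2)) := by
    refine Summable.of_nonneg_of_le (fun _ => (Real.exp_pos _).le) (fun n => ?_)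
      (Real.summable_exp_nat_mul_iff.mpr (neg_lt_zero.mpr hc))
    rw [Real.exp_le_exp]
    have : (n : ℝ) ≤ (n : ℝ) ^ 2 := by exact_mod_cast Nat.le_self_pow two_ne_zero n
    nlinarith
  exact Summable.of_nat_of_neg (by simpa using hn) (by simpa using hn)

theorem summable_exp_neg_mul_sqNorm_intVec {c : ℝ} (hc : 0 < c) :
    Summable fun n : Fin d → ℤ => Real.exp (-(c * sqNorm (intVec n))) := by
  classical
  have h1 := summable_exp_neg_mul_int_sq hc
  refine summable_of_sum_le (c := (∑' n : ℤ, Real.exp (-(c * (n : ℝ) ^ 2))) ^ d)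
    (fun _ => (Real.exp_pos _).le) fun s => ?_
  let t : Finset ℤ := Finset.univ.biUnion fun i : Fin d => s.image fun n => n i
  have hs : s ⊆ Fintype.piFinset fun _ : Fin d => t := by
    intro n hn
    simp only [Fintype.mem_piFinset, t, Finset.mem_biUnion, Finset.mem_image]
    exact fun i => ⟨i, Finset.mem_univ _, n, hn, rfl⟩
  calc _ ≤ ∑ n ∈ Fintype.piFinset fun _ : Fin d => t, Real.exp (-(c * sqNorm (intVec n))) :=
        Finset.sum_le_sum_of_subset_of_nonneg hs fun _ _ _ => (Real.exp_pos _).le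
    _ = ∑ n ∈ Fintype.piFinset fun _ : Fin d => t, ∏ i, Real.exp (-(c * (n i : ℝ) ^ 2)) := by
        refine Finset.sum_congr rfl fun n _ => ?_
        rw [← Real.exp_sum, sqNorm, Finset.mul_sum, Finset.sum_neg_distrib]
        rfl
    _ = (∑ n ∈ t, Real.exp (-(c * (n : ℝ) ^ 2))) ^ d := by
        rw [Finset.sum_prod_piFinset t fun _ n => Real.exp (-(c * (n : ℝ) ^ 2))]
        simp
    _ ≤ _ := by
        gcongr
        exact h1.sum_le_tsum _ fun _ _ => (Real.exp_pos _).le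

theorem summable_exp_neg_mul_sqNorm_mulVec_add {M M' : Matrix (Fin d) (Fin d) ℝ}
    (h : M' * M = 1) {c : ℝ} (hc : 0 < c) (x : Fin d → ℝ) :
    Summable fun n : Fin d → ℤ => Real.exp (-(c * sqNorm (M.mulVec (intVec n + x)))) := by
  obtain ⟨κ, hκ, hM⟩ := exists_le_sqNorm_mulVec h
  have h2 := (summable_exp_neg_mul_sqNorm_intVec (d := d) (c := c * κ / 2) (by positivity)).mul_left
    (Real.exp (c * κ * sqNorm x))
  refine Summable.of_nonneg_of_le (fun _ => (Real.exp_pos _).le) (fun n => ?_) h2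
  rw [← Real.exp_add, Real.exp_le_exp]
  have h3 := mul_le_mul_of_nonneg_left (hM (intVec n + x)) hc.le
  have h4 := mul_le_mul_of_nonneg_left (sqNorm_le_two_mul_add (intVec n) x)
    (show 0 ≤ c * κ / 2 by positivity)
  nlinarith

end Quadratic

section Poisson

variable {d : ℕ}

/-- The projection of `ℝ^d` onto the torus. -/
def toTorus (x : Fin d → ℝ) : UnitAddTorus (Fin d) := fun i => (x i : UnitAddCircle)

theorem isOpenQuotientMap_toTorus : IsOpenQuotientMap (toTorus (d := d)) :=
  IsOpenQuotientMap.piMap fun _ => QuotientAddGroup.isOpenQuotientMap_mk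

theorem toTorus_eq_iff {x y : Fin d → ℝ} :
    toTorus x = toTorus y ↔ ∃ n : Fin d → ℤ, x = y + intVec n := by
  constructor
  · intro h
    have : ∀ i, ∃ n : ℤ, x i = y i + n := fun i => by
      have := congrFun h i
      simp only [toTorus] at this
      rw [← sub_eq_zero, ← AddCircle.coe_sub, AddCircle.coe_eq_zero_iff] at this
      obtain ⟨n, hn⟩ := this
      exact ⟨n, by simp at hn; linarith⟩
    choose n hn using this
    exact ⟨n, funext hn⟩
  · rintro ⟨n, rfl⟩
    funext i
    simp [toTorus, intVec]

theorem mFourier_toTorus (m : Fin d → ℤ) (x : Fin d → ℝ) :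
    UnitAddTorus.mFourier m (toTorus x) =
      Complex.exp (2 * π * Complex.I * ∑ i, (m i : ℂ) * x i) := by
  simp only [UnitAddTorus.mFourier, ContinuousMap.coe_mk, toTorus, fourier_coe_apply]
  rw [← Complex.exp_sum, Finset.mul_sum]
  congr 1
  refine Finset.sum_congr rfl fun i _ => ?_
  push_cast
  ring

theorem hasSum_integral_unit_cube {E : Type*} [NormedAddCommGroup E] [NormedSpace ℝ E]
    {h : (Fin d → ℝ) → E} (hh : Integrable h) :
    HasSum (fun n : Fin d → ℤ =>
      ∫ x in {x : Fin d → ℝ | ∀ i, x i ∈ Set.Ioc (0 : ℝ) (0 + 1)}, h (x + intVec n))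
      (∫ x, h x) := by
  set C : Set (Fin d → ℝ) := {x : Fin d → ℝ | ∀ i, x i ∈ Set.Ioc (0 : ℝ) (0 + 1)} with hC
  have hCm : MeasurableSet C := by
    have : C = Set.pi Set.univ fun _ => Set.Ioc (0 : ℝ) (0 + 1) := by ext; simp [hC]
    rw [this]
    exact MeasurableSet.univ_pi fun _ => measurableSet_Ioc
  let T : (Fin d → ℤ) → Set (Fin d → ℝ) := fun n => (fun x => x - intVec n) ⁻¹' C
  have hT : ∀ n, MeasurableSet (T n) := fun n => hCm.preimage (measurable_id.sub_const _)
  have hdisj : Pairwise (Function.onFun Disjoint T) := by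
    intro m n hmn
    rw [Function.onFun, Set.disjoint_left]
    intro x hx hy
    apply hmn
    funext i
    have h1 := hx i
    have h2 := hy i
    simp only [Pi.sub_apply, intVec, Set.mem_Ioc] at h1 h2
    have h3 : (m i : ℝ) < n i + 1 := by linarith
    have h4 : (n i : ℝ) < m i + 1 := by linarith
    have h5 : m i < n i + 1 := by exact_mod_cast h3
    have h6 : n i < m i + 1 := by exact_mod_cast h4
    omega
  have hU : ⋃ n, T n = Set.univ := by
    refine Set.eq_univ_of_forall fun x => Set.mem_iUnion.mpr ⟨fun i => ⌈x i⌉ - 1, fun i => ?_⟩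
    simp only [Pi.sub_apply, intVec, Set.mem_Ioc]
    push_cast
    constructor
    · linarith [Int.ceil_lt_add_one (x i)]
    · linarith [Int.le_ceil (x i)]
  have key := hasSum_integral_iUnion (μ := volume) (f := h) hT hdisj hh.integrableOn
  rw [hU, setIntegral_univ] at key
  refine (congrArg (fun F => HasSum F (∫ x, h x)) (funext fun n => ?_)).mpr key
  have := (measurePreserving_sub_right (volume : Measure (Fin d → ℝ)) (intVec n)).setIntegral_preimage_emb
    (MeasurableEquiv.subRight (intVec n)).measurableEmbedding (fun x => h (x + intVec n)) C
  simp only [sub_add_cancel] at this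
  exact this.symm

theorem continuous_tsum_exp_neg_sqNorm {M M' : Matrix (Fin d) (Fin d) ℝ}
    (h : M' * M = 1) {c : ℝ} (hc : 0 < c) :
    Continuous fun x : Fin d → ℝ =>
      ∑' n : Fin d → ℤ, Real.exp (-(c * sqNorm (M.mulVec (intVec n + x)))) := by
  obtain ⟨κ, hκ, hM⟩ := exists_le_sqNorm_mulVec h
  rw [continuous_iff_continuousAt]
  intro x₀
  let U : Set (Fin d → ℝ) := {x | sqNorm x < sqNorm x₀ + 1}
  have hU : IsOpen U := isOpen_lt continuous_sqNorm continuous_const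
  refine ContinuousOn.continuousAt (s := U) ?_ (hU.mem_nhds (by simp [U]))
  refine continuousOn_tsum (u := fun n => Real.exp (c * κ * (sqNorm x₀ + 1)) *
    Real.exp (-(c * κ / 2 * sqNorm (intVec n)))) (fun n => ?_)
    ((summable_exp_neg_mul_sqNorm_intVec (by positivity)).mul_left _) fun n x hx => ?_
  · have := continuous_sqNorm (d := d)
    refine Continuous.continuousOn ?_
    have h2 : Continuous fun x : Fin d → ℝ => M.mulVec (intVec n + x) :=
      Continuous.matrix_mulVec continuous_const (by fun_prop)
    fun_prop
  · rw [Real.norm_eq_abs, Real.abs_exp, ← Real.exp_add, Real.exp_le_exp]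
    have h3 := mul_le_mul_of_nonneg_left (hM (intVec n + x)) hc.le
    have h4 := mul_le_mul_of_nonneg_left (sqNorm_le_two_mul_add (intVec n) x)
      (show 0 ≤ c * κ / 2 by positivity)
    have h5 := mul_le_mul_of_nonneg_left (show sqNorm x ≤ sqNorm x₀ + 1 from hx.le)
      (show 0 ≤ c * κ by positivity)
    nlinarith

theorem measurePreserving_mulVec {B : Matrix (Fin d) (Fin d) ℝ} (hB : |B.det| = 1) :
    MeasurePreserving (fun x : Fin d → ℝ => B.mulVec x) := by
  have h0 : B.det ≠ 0 := fun h => by simp [h] at hB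
  have hc : Continuous fun x : Fin d → ℝ => B.mulVec x :=
    Continuous.matrix_mulVec continuous_const continuous_id
  refine ⟨hc.measurable, ?_⟩
  have := Real.map_matrix_volume_pi_eq_smul_volume_pi h0
  rw [abs_inv, hB] at this
  simp only [inv_one, ENNReal.ofReal_one, one_smul] at this
  exact this

theorem measurableEmbedding_mulVec {B : Matrix (Fin d) (Fin d) ℝ} (hB : |B.det| = 1) :
    MeasurableEmbedding (fun x : Fin d → ℝ => B.mulVec x) := by
  have h0 : IsUnit B := (Matrix.isUnit_iff_isUnit_det B).mpr <|
    isUnit_iff_ne_zero.mpr fun h => by simp [h] at hB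
  have hc : Continuous fun x : Fin d → ℝ => B.mulVec x :=
    Continuous.matrix_mulVec continuous_const continuous_id
  exact hc.measurableEmbedding (Matrix.mulVec_injective_iff_isUnit.mpr h0)

theorem sum_intVec_mul_eq {A B : Matrix (Fin d) (Fin d) ℝ} (hAB : A.transpose * B = 1)
    (v x : Fin d → ℝ) : ∑ i, v i * x i = ∑ i, A.mulVec v i * B.mulVec x i := by
  have : v ⬝ᵥ x = A.mulVec v ⬝ᵥ B.mulVec x := by
    rw [Matrix.dotProduct_mulVec, ← Matrix.mulVec_transpose, Matrix.mulVec_mulVec]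
    have h2 : B.transpose * A = 1 := by
      rw [← Matrix.transpose_transpose A, ← Matrix.transpose_mul, hAB, Matrix.transpose_one]
    rw [h2, Matrix.one_mulVec]
  exact this

/-- The Fourier transform of a Gaussian adapted to the quadratic form of `B`, in integrable form. -/
theorem gaussian_fourier {A B : Matrix (Fin d) (Fin d) ℝ} (hAB : A.transpose * B = 1)
    (hB : |B.det| = 1) {α : ℝ} (hα : 0 < α) (m : Fin d → ℤ) :
    Integrable (fun x : Fin d → ℝ => UnitAddTorus.mFourier (-m) (toTorus x) *
      ((Real.exp (-(π * α * sqNorm (B.mulVec x))) : ℝ) : ℂ)) ∧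
    ∫ x : Fin d → ℝ, UnitAddTorus.mFourier (-m) (toTorus x) *
      ((Real.exp (-(π * α * sqNorm (B.mulVec x))) : ℝ) : ℂ) =
      (((1 / α) ^ ((d : ℝ) / 2) * Real.exp (-(π / α * sqNorm (A.mulVec (intVec m)))) : ℝ) : ℂ) := by
  let c : Fin d → ℂ := fun i => -(2 * π * Complex.I * (A.mulVec (intVec m) i : ℂ))
  let b : ℂ := ((π * α : ℝ) : ℂ)
  have hb : 0 < b.re := by simp only [b, Complex.ofReal_re]; positivity
  have hfun : (fun x : Fin d → ℝ => UnitAddTorus.mFourier (-m) (toTorus x) *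
      ((Real.exp (-(π * α * sqNorm (B.mulVec x))) : ℝ) : ℂ)) =
      (fun v : Fin d → ℝ => Complex.exp (-b * ∑ i, (v i : ℂ) ^ 2 + ∑ i, c i * v i)) ∘
        fun x => B.mulVec x := by
    funext x
    have h1 : ∑ i, ((-m) i : ℂ) * (x i : ℂ) =
        -∑ i, (A.mulVec (intVec m) i : ℂ) * (B.mulVec x i : ℂ) := by
      have := congrArg (fun r : ℝ => (r : ℂ)) (sum_intVec_mul_eq hAB (intVec m) x)
      push_cast at this
      rw [← this, ← Finset.sum_neg_distrib]
      exact Finset.sum_congr rfl fun i _ => by simp [intVec]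
    rw [mFourier_toTorus, Complex.ofReal_exp, ← Complex.exp_add, Function.comp_apply]
    congr 1
    simp only [c, b, sqNorm, h1]
    push_cast
    simp only [Finset.mul_sum, ← Finset.sum_neg_distrib, ← Finset.sum_add_distrib]
    exact Finset.sum_congr rfl fun i _ => by ring
  rw [hfun]
  have hmp := measurePreserving_mulVec hB
  have hme := measurableEmbedding_mulVec hB
  refine ⟨(hmp.integrable_comp_emb hme).mpr
    (GaussianFourier.integrable_cexp_neg_mul_sum_add hb c), ?_⟩
  refine (hmp.integral_comp hme
    (fun v => Complex.exp (-b * ∑ i, (v i : ℂ) ^ 2 + ∑ i, c i * v i))).trans ?_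
  rw [GaussianFourier.integral_cexp_neg_mul_sum_add hb c]
  have h1 : (π : ℂ) / b = ((1 / α : ℝ) : ℂ) := by
    simp only [b]; push_cast
    have : (π : ℂ) ≠ 0 := by exact_mod_cast Real.pi_ne_zero
    have : (α : ℂ) ≠ 0 := by exact_mod_cast hα.ne'
    field_simp
  have h2 : (∑ i, c i ^ 2) / (4 * b) = ((-(π / α * sqNorm (A.mulVec (intVec m))) : ℝ) : ℂ) := by
    simp only [c, b, sqNorm]
    push_cast
    have : (π : ℂ) ≠ 0 := by exact_mod_cast Real.pi_ne_zero
    have : (α : ℂ) ≠ 0 := by exact_mod_cast hα.ne'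
    rw [Finset.sum_div, Finset.mul_sum, ← Finset.sum_neg_distrib]
    refine Finset.sum_congr rfl fun i _ => ?_
    have hI := Complex.I_sq
    field_simp
    linear_combination (4 * (A.mulVec (intVec m) i : ℂ) ^ 2) * hI
  rw [h1, h2, Complex.ofReal_mul, Complex.ofReal_exp,
    Complex.ofReal_cpow (by positivity : 0 ≤ 1 / α)]
  simp

theorem poisson_gaussian {A B : Matrix (Fin d) (Fin d) ℝ} (hAB : A.transpose * B = 1)
    (hB : |B.det| = 1) {α : ℝ} (hα : 0 < α) (ξ : Fin d → ℝ) :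
    ∑' n : Fin d → ℤ, Real.exp (-(π * α * sqNorm (B.mulVec (intVec n + ξ)))) =
      (1 / α) ^ ((d : ℝ) / 2) * ∑' m : Fin d → ℤ,
        Real.exp (-(π / α * sqNorm (A.mulVec (intVec m)))) *
          Real.cos (2 * π * ∑ i, intVec m i * ξ i) := by
  have hπα : 0 < π * α := by positivity
  have hBA : B.transpose * A = 1 := by
    rw [← Matrix.transpose_transpose A, ← Matrix.transpose_mul, hAB, Matrix.transpose_one]
  let F : (Fin d → ℝ) → ℝ := fun x =>
    ∑' n : Fin d → ℤ, Real.exp (-(π * α * sqNorm (B.mulVec (intVec n + x))))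
  have hFc : Continuous F := continuous_tsum_exp_neg_sqNorm hAB hπα
  have hFper : ∀ x y, toTorus x = toTorus y → F x = F y := by
    intro x y hxy
    obtain ⟨k, rfl⟩ := toTorus_eq_iff.mp hxy
    refine Eq.trans ?_ ((Equiv.addRight k).tsum_eq
      fun n => Real.exp (-(π * α * sqNorm (B.mulVec (intVec n + y)))))
    refine tsum_congr fun n => ?_
    rw [Equiv.coe_addRight, intVec_add, add_assoc, add_comm (intVec k)]
  have hq := (isOpenQuotientMap_toTorus (d := d))
  let G : UnitAddTorus (Fin d) → ℂ := fun t => (F (Function.surjInv hq.surjective t) : ℂ)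
  have hG : ∀ x, G (toTorus x) = F x := fun x => by
    simp only [G]
    rw [hFper _ x (Function.surjInv_eq hq.surjective _)]
  have hGc : Continuous G := by
    rw [hq.isQuotientMap.continuous_iff]
    have : G ∘ toTorus = fun x => (F x : ℂ) := funext hG
    rw [this]
    exact Complex.continuous_ofReal.comp hFc
  let Gc : C(UnitAddTorus (Fin d), ℂ) := ⟨G, hGc⟩
  have hcoef : ∀ m, UnitAddTorus.mFourierCoeff Gc m =
      (((1 / α) ^ ((d : ℝ) / 2) * Real.exp (-(π / α * sqNorm (A.mulVec (intVec m)))) : ℝ) : ℂ) := by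
    intro m
    obtain ⟨hi, he⟩ := gaussian_fourier hAB hB hα m
    rw [← he, UnitAddTorus.mFourierCoeff_eq_integral Gc m 0]
    have hper : ∀ (x : Fin d → ℝ) (n : Fin d → ℤ), toTorus (x + intVec n) = toTorus x :=
      fun x n => toTorus_eq_iff.mpr ⟨n, rfl⟩
    have h1 := hasSum_integral_unit_cube hi
    have h2 := (hasSum_integral_unit_cube hi.norm).summable
    rw [← h1.tsum_eq, integral_tsum_of_summable_integral_norm
      (fun n => (hi.comp_add_right (intVec n)).integrableOn) h2]
    congr 1
    funext x
    change _ * G (toTorus x) = _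
    simp only [hper, hG, F]
    rw [Complex.ofReal_tsum, ← tsum_mul_left]
    refine tsum_congr fun n => ?_
    rw [add_comm x]
    rfl
  have hsA : Summable fun m : Fin d → ℤ => Real.exp (-(π / α * sqNorm (A.mulVec (intVec m)))) := by
    have hA : B.transpose * A = 1 := hBA
    simpa using summable_exp_neg_mul_sqNorm_mulVec_add hA (c := π / α) (by positivity) 0
  have hs : Summable (UnitAddTorus.mFourierCoeff Gc) := by
    rw [funext hcoef]
    exact Complex.summable_ofReal.mpr (hsA.mul_left _)
  have := UnitAddTorus.hasSum_mFourier_series_apply_of_summable hs (toTorus ξ)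
  have hre := Complex.hasSum_re this
  have hGr : (Gc (toTorus ξ)).re = F ξ := by
    change (G (toTorus ξ)).re = _
    rw [hG, Complex.ofReal_re]
  rw [hGr] at hre
  change F ξ = _
  rw [← hre.tsum_eq, ← tsum_mul_left]
  refine tsum_congr fun m => ?_
  rw [hcoef, smul_eq_mul, Complex.re_ofReal_mul, mFourier_toTorus]
  have : 2 * (π : ℂ) * Complex.I * ∑ i, (m i : ℂ) * (ξ i : ℂ) =
      ((2 * π * ∑ i, intVec m i * ξ i : ℝ) : ℂ) * Complex.I := by
    simp only [intVec]; push_cast; ring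
  rw [this, Complex.exp_ofReal_mul_I_re]
  ring

end Poisson

section Theta

variable {d : ℕ}

/-- The cosine character `m ↦ cos (2π m·ξ)` of `ℤ^d`. -/
noncomputable def cosChar (ξ : Fin d → ℝ) (m : Fin d → ℤ) : ℝ :=
  Real.cos (2 * π * ∑ i, intVec m i * ξ i)

theorem abs_cosChar_le_one (ξ : Fin d → ℝ) (m : Fin d → ℤ) : |cosChar ξ m| ≤ 1 :=
  Real.abs_cos_le_one _

theorem cosChar_zero (ξ : Fin d → ℝ) : cosChar ξ 0 = 1 := by
  simp [cosChar, intVec]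

/-- The theta function of the lattice `Aℤ^d` with the origin removed and phases given by `ξ`. -/
noncomputable def puncturedTheta (A : Matrix (Fin d) (Fin d) ℝ) (ξ : Fin d → ℝ) (u : ℝ) : ℝ :=
  ∑' m : {m : Fin d → ℤ // m ≠ 0}, Real.exp (-(u * sqNorm (A.mulVec (intVec m.1)))) * cosChar ξ m.1

theorem summable_exp_neg_mul_sqNorm_mulVec {A A' : Matrix (Fin d) (Fin d) ℝ} (hA : A' * A = 1)
    {u : ℝ} (hu : 0 < u) :
    Summable fun m : Fin d → ℤ => Real.exp (-(u * sqNorm (A.mulVec (intVec m)))) := by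
  simpa using summable_exp_neg_mul_sqNorm_mulVec_add hA hu 0

theorem summable_exp_neg_mul_cosChar {A A' : Matrix (Fin d) (Fin d) ℝ} (hA : A' * A = 1)
    {u : ℝ} (hu : 0 < u) (ξ : Fin d → ℝ) :
    Summable fun m : Fin d → ℤ =>
      Real.exp (-(u * sqNorm (A.mulVec (intVec m)))) * cosChar ξ m := by
  refine Summable.of_norm_bounded (summable_exp_neg_mul_sqNorm_mulVec hA hu) fun m => ?_
  rw [norm_mul, Real.norm_eq_abs, Real.abs_exp]
  exact mul_le_of_le_one_right (Real.exp_pos _).le (abs_cosChar_le_one ξ m)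

theorem one_add_puncturedTheta {A B : Matrix (Fin d) (Fin d) ℝ} (hAB : A.transpose * B = 1)
    (hB : |B.det| = 1) {u : ℝ} (hu : 0 < u) (ξ : Fin d → ℝ) :
    1 + puncturedTheta A ξ u = (π / u) ^ ((d : ℝ) / 2) *
      ∑' n : Fin d → ℤ, Real.exp (-(π * (π / u) * sqNorm (B.mulVec (intVec n + ξ)))) := by
  have hBA : B.transpose * A = 1 := by
    rw [← Matrix.transpose_transpose A, ← Matrix.transpose_mul, hAB, Matrix.transpose_one]
  have hπ := Real.pi_pos
  have hα : 0 < π / u := by positivity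
  rw [poisson_gaussian hAB hB hα ξ, ← mul_assoc, ← Real.mul_rpow (by positivity) (by positivity),
    mul_one_div_cancel hα.ne', Real.one_rpow, one_mul]
  have hu' : π / (π / u) = u := by field_simp
  rw [hu']
  have h := (summable_exp_neg_mul_cosChar hBA hu ξ).tsum_subtype_add_tsum_subtype_compl {0}
  rw [tsum_singleton (0 : Fin d → ℤ)
    (fun m => Real.exp (-(u * sqNorm (A.mulVec (intVec m)))) * cosChar ξ m)] at h
  refine Eq.trans ?_ h
  congr 1
  simp [cosChar_zero, intVec, sqNorm, Matrix.mulVec, dotProduct]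

theorem exists_le_sqNorm_mulVec_intVec_add {B B' : Matrix (Fin d) (Fin d) ℝ} (hB : B' * B = 1)
    {ξ : Fin d → ℝ} (hξ : ¬ ∃ k : Fin d → ℤ, ξ = intVec k) :
    ∃ ρ : ℝ, 0 < ρ ∧ ∀ n : Fin d → ℤ, ρ ≤ sqNorm (B.mulVec (intVec n + ξ)) := by
  obtain ⟨κ, hκ, hM⟩ := exists_le_sqNorm_mulVec hB
  have : ∃ i, ξ i ≠ round (ξ i) := by
    by_contra! h
    exact hξ ⟨fun i => round (ξ i), funext h⟩
  obtain ⟨i, hi⟩ := this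
  refine ⟨κ * |ξ i - round (ξ i)| ^ 2, ?_, fun n => ?_⟩
  · have := abs_pos.mpr (sub_ne_zero.mpr hi)
    positivity
  · refine le_trans (mul_le_mul_of_nonneg_left ?_ hκ.le) (hM _)
    refine le_trans ?_ (Finset.single_le_sum (f := fun i => (intVec n + ξ) i ^ 2)
      (fun i _ => sq_nonneg _) (Finset.mem_univ i))
    have h1 := round_le (ξ i) (-n i)
    rw [← sq_abs ((intVec n + ξ) i)]
    refine pow_le_pow_left₀ (abs_nonneg _) (h1.trans_eq ?_) 2
    simp only [intVec, Pi.add_apply]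
    push_cast
    congr 1
    ring

theorem tendsto_puncturedTheta_zero {A B : Matrix (Fin d) (Fin d) ℝ} (hAB : A.transpose * B = 1)
    (hB : |B.det| = 1) {ξ : Fin d → ℝ} (hξ : ¬ ∃ k : Fin d → ℤ, ξ = intVec k) :
    Tendsto (puncturedTheta A ξ) (𝓝[>] 0) (𝓝 (-1)) := by
  have hπ := Real.pi_pos
  obtain ⟨ρ, hρ, hρn⟩ := exists_le_sqNorm_mulVec_intVec_add hAB hξ
  have hS := summable_exp_neg_mul_sqNorm_mulVec_add hAB (c := π * π / 4) (by positivity) ξ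
  set S := ∑' n : Fin d → ℤ, Real.exp (-(π * π / 4 * sqNorm (B.mulVec (intVec n + ξ)))) with hSdef
  have hlim : Tendsto (fun u : ℝ => (π / u) ^ ((d : ℝ) / 2) *
      Real.exp (-(π * ρ / 2) * (π / u)) * S) (𝓝[>] 0) (𝓝 (0 * S)) := by
    refine Tendsto.mul_const _ ?_
    have h1 := tendsto_rpow_mul_exp_neg_mul_atTop_nhds_zero ((d : ℝ) / 2) (π * ρ / 2)
      (by positivity)
    have h2 : Tendsto (fun u : ℝ => π / u) (𝓝[>] 0) atTop := by
      simp only [div_eq_mul_inv]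
      exact Tendsto.const_mul_atTop hπ tendsto_inv_nhdsGT_zero
    exact h1.comp h2
  rw [zero_mul] at hlim
  have h2 : Tendsto (fun u => 1 + puncturedTheta A ξ u) (𝓝[>] 0) (𝓝 0) := by
    refine squeeze_zero' ?_ ?_ hlim
    · filter_upwards [self_mem_nhdsWithin] with u hu
      rw [Set.mem_Ioi] at hu
      rw [one_add_puncturedTheta hAB hB hu]
      exact mul_nonneg (by positivity) (tsum_nonneg fun _ => (Real.exp_pos _).le)
    · filter_upwards [Ioo_mem_nhdsGT (show (0 : ℝ) < 2 by norm_num)] with u hu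
      obtain ⟨hu, hu2⟩ := hu
      rw [one_add_puncturedTheta hAB hB hu, mul_assoc]
      refine mul_le_mul_of_nonneg_left ?_ (by positivity)
      rw [hSdef, ← tsum_mul_left]
      refine Summable.tsum_le_tsum (fun n => ?_)
        (summable_exp_neg_mul_sqNorm_mulVec_add hAB (by positivity) ξ) (hS.mul_left _)
      rw [← Real.exp_add, Real.exp_le_exp]
      have h3 : π / 2 ≤ π / u := by gcongr
      have h4 := hρn n
      have h5 : 0 ≤ sqNorm (B.mulVec (intVec n + ξ)) := sqNorm_nonneg _
      have h6 := mul_le_mul_of_nonneg_left h4 (show 0 ≤ π * (π / u) / 2 by positivity)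
      have h7 := mul_le_mul_of_nonneg_right h3 (show 0 ≤ π / 2 * sqNorm (B.mulVec (intVec n + ξ)) by positivity)
      nlinarith
  have h3 := h2.const_add (-1)
  simpa using h3

theorem exists_abs_puncturedTheta_le {A B : Matrix (Fin d) (Fin d) ℝ}
    (hAB : A.transpose * B = 1) (hB : |B.det| = 1) {ξ : Fin d → ℝ}
    (hξ : ¬ ∃ k : Fin d → ℤ, ξ = intVec k) :
    ∃ C r : ℝ, 0 < r ∧ ∀ u, 0 < u → |puncturedTheta A ξ u| ≤ C * Real.exp (-(r * u)) := by
  have hBA : B.transpose * A = 1 := by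
    rw [← Matrix.transpose_transpose A, ← Matrix.transpose_mul, hAB, Matrix.transpose_one]
  obtain ⟨κ, hκ, hM⟩ := exists_le_sqNorm_mulVec hBA
  have h1 : ∀ᶠ u in 𝓝[>] (0 : ℝ), |puncturedTheta A ξ u| ≤ 2 := by
    have := (tendsto_puncturedTheta_zero hAB hB hξ).abs
    exact this.eventually_le_const (by norm_num)
  obtain ⟨δ, hδ, hδ2⟩ := mem_nhdsGT_iff_exists_Ioo_subset.mp h1
  rw [Set.mem_Ioi] at hδ
  have hs := (summable_exp_neg_mul_sqNorm_mulVec hBA hδ)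
  have hs' : Summable fun m : {m : Fin d → ℤ // m ≠ 0} =>
    Real.exp (-(δ * sqNorm (A.mulVec (intVec m.1)))) := hs.subtype _
  set D := ∑' m : {m : Fin d → ℤ // m ≠ 0}, Real.exp (-(δ * sqNorm (A.mulVec (intVec m.1))))
  refine ⟨max 2 D * Real.exp (κ * δ), κ, hκ, fun u hu => ?_⟩
  rw [mul_assoc, ← Real.exp_add]
  rcases lt_or_ge u δ with hlt | hge
  · calc |puncturedTheta A ξ u| ≤ 2 := hδ2 ⟨hu, hlt⟩
      _ ≤ max 2 D := le_max_left _ _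
      _ ≤ _ := le_mul_of_one_le_right (by positivity) (Real.one_le_exp (by nlinarith))
  · calc |puncturedTheta A ξ u| ≤ D * Real.exp (κ * δ + -(κ * u)) := by
          rw [← tsum_mul_right, ← Real.norm_eq_abs]
          refine tsum_of_norm_bounded (hs'.mul_right _).hasSum fun m => ?_
          rw [norm_mul, Real.norm_eq_abs, Real.abs_exp]
          refine (mul_le_of_le_one_right (Real.exp_pos _).le (abs_cosChar_le_one ξ _)).trans ?_
          rw [← Real.exp_add, Real.exp_le_exp]
          have h2 : κ ≤ sqNorm (A.mulVec (intVec m.1)) :=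
            le_trans (le_mul_of_one_le_right hκ.le (one_le_sqNorm_intVec m.2)) (hM _)
          nlinarith
      _ ≤ _ := by
          gcongr
          exact le_max_right _ _

theorem continuousOn_puncturedTheta {A A' : Matrix (Fin d) (Fin d) ℝ} (hA : A' * A = 1)
    (ξ : Fin d → ℝ) : ContinuousOn (puncturedTheta A ξ) (Set.Ioi 0) := by
  intro t ht
  rw [Set.mem_Ioi] at ht
  refine ContinuousAt.continuousWithinAt ?_
  refine ContinuousOn.continuousAt (s := Set.Ioi (t / 2)) ?_ (Ioi_mem_nhds (by linarith))
  refine continuousOn_tsum (u := fun m : {m : Fin d → ℤ // m ≠ 0} =>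
    Real.exp (-(t / 2 * sqNorm (A.mulVec (intVec m.1))))) (fun m => by fun_prop)
    ((summable_exp_neg_mul_sqNorm_mulVec hA (half_pos ht)).subtype _) fun m u hu => ?_
  rw [norm_mul, Real.norm_eq_abs, Real.abs_exp]
  refine (mul_le_of_le_one_right (Real.exp_pos _).le (abs_cosChar_le_one ξ _)).trans ?_
  rw [Real.exp_le_exp, neg_le_neg_iff]
  exact mul_le_mul_of_nonneg_right (le_of_lt hu) (sqNorm_nonneg _)

theorem puncturedTheta_le {A B : Matrix (Fin d) (Fin d) ℝ} (hAB : A.transpose * B = 1)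
    (hB : |B.det| = 1) {ξ₀ : Fin d → ℝ}
    (hmin : ∀ α : ℝ, 0 < α → ∀ ξ : Fin d → ℝ,
      ∑' n : Fin d → ℤ, Real.exp (-(π * α * sqNorm (B.mulVec (intVec n + ξ₀)))) ≤
        ∑' n : Fin d → ℤ, Real.exp (-(π * α * sqNorm (B.mulVec (intVec n + ξ)))))
    {u : ℝ} (hu : 0 < u) (ξ : Fin d → ℝ) : puncturedTheta A ξ₀ u ≤ puncturedTheta A ξ u := by
  have h := mul_le_mul_of_nonneg_left (hmin (π / u) (by positivity) ξ)
    (show 0 ≤ (π / u) ^ ((d : ℝ) / 2) by positivity)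
  rw [← one_add_puncturedTheta hAB hB hu, ← one_add_puncturedTheta hAB hB hu] at h
  linarith

end Theta

section Damped

variable {d : ℕ}

/-- The lattice sum of `f` with Gaussian damping `η` and phases given by `ξ`. -/
noncomputable def dampedSum (A : Matrix (Fin d) (Fin d) ℝ) (f : (Fin d → ℝ) → ℝ) (ξ : Fin d → ℝ)
    (η : ℝ) : ℝ :=
  ∑' m : {m : Fin d → ℤ // m ≠ 0},
    cosChar ξ m.1 * (f (A.mulVec (intVec m.1)) * Real.exp (-(η * sqNorm (A.mulVec (intVec m.1)))))

theorem integrableOn_exp_neg_mul (hd : 1 ≤ d) {μ : Measure ℝ}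
    (hμf : ∀ x : Fin d → ℝ, x ≠ 0 →
      IntegrableOn (fun t : ℝ => Real.exp (-sqNorm x * t)) (Set.Ici 0) μ) {r : ℝ} (hr : 0 < r) :
    IntegrableOn (fun t : ℝ => Real.exp (-(r * t))) (Set.Ici 0) μ := by
  let i : Fin d := ⟨0, hd⟩
  have hq : sqNorm (Pi.single i (√r) : Fin d → ℝ) = r := by
    unfold sqNorm
    rw [Finset.sum_eq_single i]
    · simp [Real.sq_sqrt hr.le]
    · intro j _ hj; simp [hj]
    · simp
  have hne : (Pi.single i (√r) : Fin d → ℝ) ≠ 0 := fun h => by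
    rw [h] at hq; simp [sqNorm] at hq; exact hr.ne hq
  have := hμf _ hne
  rw [hq] at this
  simpa using this

variable {A B : Matrix (Fin d) (Fin d) ℝ} {μ : Measure ℝ} {f : (Fin d → ℝ) → ℝ}

theorem summable_mul_exp_neg (hd : 1 ≤ d) (hBA : B.transpose * A = 1)
    (hμf : ∀ x : Fin d → ℝ, x ≠ 0 →
      IntegrableOn (fun t : ℝ => Real.exp (-sqNorm x * t)) (Set.Ici 0) μ)
    (hf : ∀ x : Fin d → ℝ, x ≠ 0 → f x = ∫ t in Set.Ici 0, Real.exp (-sqNorm x * t) ∂μ)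
    {η : ℝ} (hη : 0 < η) :
    (∀ m : {m : Fin d → ℤ // m ≠ 0}, A.mulVec (intVec m.1) ≠ 0 ∧ 0 ≤ f (A.mulVec (intVec m.1))) ∧
    Summable fun m : {m : Fin d → ℤ // m ≠ 0} =>
      f (A.mulVec (intVec m.1)) * Real.exp (-(η * sqNorm (A.mulVec (intVec m.1)))) := by
  obtain ⟨κ, hκ, hM⟩ := exists_le_sqNorm_mulVec hBA
  have hq : ∀ m : {m : Fin d → ℤ // m ≠ 0}, κ ≤ sqNorm (A.mulVec (intVec m.1)) := fun m =>
    le_trans (le_mul_of_one_le_right hκ.le (one_le_sqNorm_intVec m.2)) (hM _)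
  have hne : ∀ m : {m : Fin d → ℤ // m ≠ 0}, A.mulVec (intVec m.1) ≠ 0 := fun m h => by
    have := hq m
    rw [h] at this
    simp [sqNorm] at this
    linarith
  have hf0 : ∀ m : {m : Fin d → ℤ // m ≠ 0}, 0 ≤ f (A.mulVec (intVec m.1)) := fun m => by
    rw [hf _ (hne m)]
    exact integral_nonneg fun _ => (Real.exp_pos _).le
  refine ⟨fun m => ⟨hne m, hf0 m⟩, ?_⟩
  refine Summable.of_nonneg_of_le (fun m => mul_nonneg (hf0 m) (Real.exp_pos _).le) (fun m => ?_)
    (((summable_exp_neg_mul_sqNorm_mulVec hBA hη).subtype {m | m ≠ 0}).mul_left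
      (∫ t in Set.Ici 0, Real.exp (-(κ * t)) ∂μ))
  refine mul_le_mul_of_nonneg_right ?_ (Real.exp_pos _).le
  rw [hf _ (hne m)]
  refine setIntegral_mono_on (hμf _ (hne m)) (integrableOn_exp_neg_mul hd hμf hκ)
    measurableSet_Ici fun t ht => ?_
  rw [Real.exp_le_exp, neg_mul, neg_le_neg_iff]
  exact mul_le_mul_of_nonneg_right (hq m) ht

theorem dampedSum_eq_integral (hd : 1 ≤ d) (hBA : B.transpose * A = 1)
    (hμf : ∀ x : Fin d → ℝ, x ≠ 0 →
      IntegrableOn (fun t : ℝ => Real.exp (-sqNorm x * t)) (Set.Ici 0) μ)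
    (hf : ∀ x : Fin d → ℝ, x ≠ 0 → f x = ∫ t in Set.Ici 0, Real.exp (-sqNorm x * t) ∂μ)
    {η : ℝ} (hη : 0 < η) (ξ : Fin d → ℝ) :
    dampedSum A f ξ η = ∫ t in Set.Ici 0, puncturedTheta A ξ (t + η) ∂μ := by
  obtain ⟨hm, hs⟩ := summable_mul_exp_neg hd hBA hμf hf hη
  have hF : ∀ (m : {m : Fin d → ℤ // m ≠ 0}) (t : ℝ),
      Real.exp (-((t + η) * sqNorm (A.mulVec (intVec m.1)))) * cosChar ξ m.1 =
      Real.exp (-sqNorm (A.mulVec (intVec m.1)) * t) *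
        (Real.exp (-(η * sqNorm (A.mulVec (intVec m.1)))) * cosChar ξ m.1) := fun m t => by
    rw [← mul_assoc, ← Real.exp_add]
    congr 2
    ring
  have hnorm : ∀ m : {m : Fin d → ℤ // m ≠ 0}, ∫ t in Set.Ici 0,
      ‖Real.exp (-((t + η) * sqNorm (A.mulVec (intVec m.1)))) * cosChar ξ m.1‖ ∂μ =
      f (A.mulVec (intVec m.1)) * Real.exp (-(η * sqNorm (A.mulVec (intVec m.1)))) *
        |cosChar ξ m.1| := fun m => by
    simp only [hF, norm_mul, Real.norm_eq_abs, Real.abs_exp]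
    rw [integral_mul_const, hf _ (hm m).1, mul_assoc]
  unfold puncturedTheta
  rw [← integral_tsum_of_summable_integral_norm (F := fun (m : {m : Fin d → ℤ // m ≠ 0}) t =>
    Real.exp (-((t + η) * sqNorm (A.mulVec (intVec m.1)))) * cosChar ξ m.1)]
  · refine tsum_congr fun m => ?_
    simp only [hF]
    rw [integral_mul_const, hf _ (hm m).1]
    ring
  · intro m
    simp only [hF]
    exact (hμf _ (hm m).1).mul_const _
  · simp only [hnorm]
    refine Summable.of_nonneg_of_le (fun m => ?_) (fun m => ?_) hs
    · have := (hm m).2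
      positivity
    · refine mul_le_of_le_one_right ?_ (abs_cosChar_le_one ξ _)
      have := (hm m).2
      positivity

theorem exists_tendsto_dampedSum (hd : 1 ≤ d) (hAB : A.transpose * B = 1) (hB : |B.det| = 1)
    (hμf : ∀ x : Fin d → ℝ, x ≠ 0 →
      IntegrableOn (fun t : ℝ => Real.exp (-sqNorm x * t)) (Set.Ici 0) μ)
    (hf : ∀ x : Fin d → ℝ, x ≠ 0 → f x = ∫ t in Set.Ici 0, Real.exp (-sqNorm x * t) ∂μ)
    {ξ : Fin d → ℝ} (hξ : ¬ ∃ k : Fin d → ℤ, ξ = intVec k) :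
    ∃ e, Tendsto (dampedSum A f ξ) (𝓝[>] 0) (𝓝 e) := by
  have hBA : B.transpose * A = 1 := by
    rw [← Matrix.transpose_transpose A, ← Matrix.transpose_mul, hAB, Matrix.transpose_one]
  obtain ⟨C, r, hr, hC⟩ := exists_abs_puncturedTheta_le hAB hB hξ
  have hC0 : 0 ≤ C := by
    have := (abs_nonneg _).trans (hC 1 one_pos)
    exact nonneg_of_mul_nonneg_left this (Real.exp_pos _)
  have hcont := continuousOn_puncturedTheta hBA ξ
  refine ⟨∫ t in Set.Ici 0, (if 0 < t then puncturedTheta A ξ t else -1) ∂μ, ?_⟩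
  have key : Tendsto (fun η => ∫ t in Set.Ici 0, puncturedTheta A ξ (t + η) ∂μ) (𝓝[>] 0)
      (𝓝 (∫ t in Set.Ici 0, (if 0 < t then puncturedTheta A ξ t else -1) ∂μ)) := by
    refine tendsto_integral_filter_of_dominated_convergence (fun t => C * Real.exp (-(r * t)))
      ?_ ?_ ((integrableOn_exp_neg_mul hd hμf hr).const_mul C) ?_
    · filter_upwards [self_mem_nhdsWithin] with η hη
      rw [Set.mem_Ioi] at hη
      refine ContinuousOn.aestronglyMeasurable ?_ measurableSet_Ici
      refine hcont.comp (by fun_prop) fun t ht => ?_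
      rw [Set.mem_Ici] at ht
      rw [Set.mem_Ioi]
      linarith
    · filter_upwards [self_mem_nhdsWithin] with η hη
      rw [Set.mem_Ioi] at hη
      filter_upwards [ae_restrict_mem measurableSet_Ici] with t ht
      rw [Set.mem_Ici] at ht
      refine (hC (t + η) (by linarith)).trans (mul_le_mul_of_nonneg_left ?_ hC0)
      rw [Real.exp_le_exp]
      nlinarith
    · filter_upwards [ae_restrict_mem measurableSet_Ici] with t ht
      rw [Set.mem_Ici] at ht
      split_ifs with h
      · have h1 : Tendsto (fun η : ℝ => t + η) (𝓝[>] 0) (𝓝 t) := by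
          have : Tendsto (fun η : ℝ => t + η) (𝓝 0) (𝓝 (t + 0)) :=
            (continuous_const.add continuous_id).tendsto 0
          rw [add_zero] at this
          exact this.mono_left nhdsWithin_le_nhds
        exact ((hcont.continuousAt (Ioi_mem_nhds h)).tendsto).comp h1
      · have : t = 0 := le_antisymm (not_lt.mp h) ht
        subst this
        simpa using tendsto_puncturedTheta_zero hAB hB hξ
  refine key.congr' ?_
  filter_upwards [self_mem_nhdsWithin] with η hη
  exact (dampedSum_eq_integral hd hBA hμf hf hη ξ).symm

theorem dampedSum_le (hd : 1 ≤ d) (hAB : A.transpose * B = 1) (hB : |B.det| = 1)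
    (hμf : ∀ x : Fin d → ℝ, x ≠ 0 →
      IntegrableOn (fun t : ℝ => Real.exp (-sqNorm x * t)) (Set.Ici 0) μ)
    (hf : ∀ x : Fin d → ℝ, x ≠ 0 → f x = ∫ t in Set.Ici 0, Real.exp (-sqNorm x * t) ∂μ)
    {ξ₀ : Fin d → ℝ}
    (hmin : ∀ α : ℝ, 0 < α → ∀ ξ : Fin d → ℝ,
      ∑' n : Fin d → ℤ, Real.exp (-(π * α * sqNorm (B.mulVec (intVec n + ξ₀)))) ≤
        ∑' n : Fin d → ℤ, Real.exp (-(π * α * sqNorm (B.mulVec (intVec n + ξ)))))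
    (hξ₀ : ¬ ∃ k : Fin d → ℤ, ξ₀ = intVec k) {ξ : Fin d → ℝ}
    (hξ : ¬ ∃ k : Fin d → ℤ, ξ = intVec k) {η : ℝ} (hη : 0 < η) :
    dampedSum A f ξ₀ η ≤ dampedSum A f ξ η := by
  have hBA : B.transpose * A = 1 := by
    rw [← Matrix.transpose_transpose A, ← Matrix.transpose_mul, hAB, Matrix.transpose_one]
  have hint : ∀ ζ : Fin d → ℝ, (¬ ∃ k : Fin d → ℤ, ζ = intVec k) →
      IntegrableOn (fun t => puncturedTheta A ζ (t + η)) (Set.Ici 0) μ := fun ζ hζ => by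
    obtain ⟨C, r, hr, hC⟩ := exists_abs_puncturedTheta_le hAB hB hζ
    refine Integrable.mono' ((integrableOn_exp_neg_mul hd hμf hr).const_mul
      (C * Real.exp (-(r * η)))) ?_ ?_
    · refine ContinuousOn.aestronglyMeasurable ?_ measurableSet_Ici
      refine (continuousOn_puncturedTheta hBA ζ).comp (by fun_prop) fun t ht => ?_
      rw [Set.mem_Ici] at ht
      rw [Set.mem_Ioi]
      linarith
    · filter_upwards [ae_restrict_mem measurableSet_Ici] with t ht
      rw [Set.mem_Ici] at ht
      refine (hC (t + η) (by linarith)).trans_eq ?_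
      rw [mul_assoc, ← Real.exp_add]
      congr 2
      ring
  rw [dampedSum_eq_integral hd hBA hμf hf hη, dampedSum_eq_integral hd hBA hμf hf hη]
  refine setIntegral_mono_on (hint _ hξ₀) (hint _ hξ) measurableSet_Ici fun t ht => ?_
  rw [Set.mem_Ici] at ht
  exact puncturedTheta_le hAB hB hmin (by linarith) ξ

end Damped

section Box

variable {d : ℕ}

/-- The fundamental cube `{0, …, L-1}^d`. -/
noncomputable def box (d L : ℕ) : Finset (Fin d → ℤ) :=
  Fintype.piFinset (fun _ : Fin d => Finset.Ico (0 : ℤ) (L : ℤ))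

theorem mem_box {L : ℕ} {y : Fin d → ℤ} : y ∈ box d L ↔ ∀ i, 0 ≤ y i ∧ y i < L := by
  simp [box, Fintype.mem_piFinset]

theorem card_box (d L : ℕ) : ((box d L).card : ℝ) = (L : ℝ) ^ d := by
  simp [box, Fintype.card_piFinset]

/-- Coordinatewise reduction modulo `L`. -/
def modBox (L : ℕ) (y : Fin d → ℤ) : Fin d → ℤ := fun i => y i % L

theorem modBox_mem {L : ℕ} (hL : 1 ≤ L) (y : Fin d → ℤ) : modBox L y ∈ box d L :=
  mem_box.mpr fun i =>
    ⟨Int.emod_nonneg _ (by omega), Int.emod_lt_of_pos _ (by omega)⟩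

theorem modBox_eq_of_mem {L : ℕ} {y : Fin d → ℤ} (hy : y ∈ box d L) : modBox L y = y :=
  funext fun i => Int.emod_eq_of_lt (mem_box.mp hy i).1 (mem_box.mp hy i).2

theorem modBox_eq_iff {L : ℕ} {x y : Fin d → ℤ} :
    modBox L x = modBox L y ↔ ∀ i, (L : ℤ) ∣ x i - y i := by
  rw [funext_iff]
  exact forall_congr' fun i =>
    Int.emod_eq_emod_iff_emod_sub_eq_zero.trans Int.dvd_iff_emod_eq_zero.symm

variable {R : Type*} {L : ℕ} {h : (Fin d → ℤ) → R}

theorem periodic_eq_of_dvd_sub (hh : ∀ (m : Fin d → ℤ) (i : Fin d), h (m + Pi.single i (L : ℤ)) = h m)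
    {x y : Fin d → ℤ} (hxy : ∀ i, (L : ℤ) ∣ x i - y i) : h x = h y := by
  choose k hk using hxy
  have key : ∀ s : Finset (Fin d),
      Function.Periodic h (∑ i ∈ s, k i • (Pi.single i (L : ℤ) : Fin d → ℤ)) := by
    intro s
    induction s using Finset.induction_on with
    | empty => intro m; simp
    | insert i s hi ih =>
      rw [Finset.sum_insert hi]
      exact Function.Periodic.add_period (Function.Periodic.zsmul (fun m => hh m i) (k i)) ih
  have hx : x = y + ∑ i, k i • (Pi.single i (L : ℤ) : Fin d → ℤ) := by
    funext j
    simp only [Pi.add_apply, Finset.sum_apply, Pi.smul_apply, Pi.single_apply, smul_eq_mul,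
      mul_ite, mul_zero, Finset.sum_ite_eq, Finset.mem_univ, if_true]
    linarith [hk j]
  rw [hx]
  exact key Finset.univ y

theorem periodic_modBox (hh : ∀ (m : Fin d → ℤ) (i : Fin d), h (m + Pi.single i (L : ℤ)) = h m)
    (x : Fin d → ℤ) : h (modBox L x) = h x :=
  periodic_eq_of_dvd_sub hh fun i => by
    rw [← Int.dvd_neg, neg_sub]
    exact Int.dvd_self_sub_emod

theorem sum_box_comp [AddCommMonoid R] (hL : 1 ≤ L)
    (hh : ∀ (m : Fin d → ℤ) (i : Fin d), h (m + Pi.single i (L : ℤ)) = h m)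
    (e : (Fin d → ℤ) ≃ (Fin d → ℤ))
    (he : ∀ x y, (∀ i, (L : ℤ) ∣ x i - y i) → ∀ i, (L : ℤ) ∣ e x i - e y i)
    (he' : ∀ x y, (∀ i, (L : ℤ) ∣ x i - y i) → ∀ i, (L : ℤ) ∣ e.symm x i - e.symm y i) :
    ∑ y ∈ box d L, h (e y) = ∑ y ∈ box d L, h y := by
  have hmod : ∀ x : Fin d → ℤ, ∀ i, (L : ℤ) ∣ modBox L x i - x i := fun x i => by
    rw [← Int.dvd_neg, neg_sub]
    exact Int.dvd_self_sub_emod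
  refine Finset.sum_nbij' (fun y => modBox L (e y)) (fun y => modBox L (e.symm y))
    (fun y _ => modBox_mem hL _) (fun y _ => modBox_mem hL _) (fun y hy => ?_) (fun y hy => ?_)
    fun y _ => (periodic_modBox hh _).symm
  · refine Eq.trans ?_ (modBox_eq_of_mem hy)
    rw [modBox_eq_iff]
    simpa using he' _ _ (hmod (e y))
  · refine Eq.trans ?_ (modBox_eq_of_mem hy)
    rw [modBox_eq_iff]
    simpa using he _ _ (hmod (e.symm y))

theorem sum_box_add [AddCommMonoid R] (hL : 1 ≤ L)
    (hh : ∀ (m : Fin d → ℤ) (i : Fin d), h (m + Pi.single i (L : ℤ)) = h m) (a : Fin d → ℤ) :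
    ∑ y ∈ box d L, h (y + a) = ∑ y ∈ box d L, h y :=
  sum_box_comp hL hh (Equiv.addRight a) (fun x y hxy i => by simpa using hxy i)
    (fun x y hxy i => by simpa using hxy i)

theorem sum_box_neg [AddCommMonoid R] (hL : 1 ≤ L)
    (hh : ∀ (m : Fin d → ℤ) (i : Fin d), h (m + Pi.single i (L : ℤ)) = h m) :
    ∑ y ∈ box d L, h (-y) = ∑ y ∈ box d L, h y :=
  sum_box_comp hL hh (Equiv.neg _)
    (fun x y hxy i => by
      have := (Int.dvd_neg (a := (L : ℤ))).mpr (hxy i)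
      simpa [sub_eq_add_neg, add_comm] using this)
    (fun x y hxy i => by
      have := (Int.dvd_neg (a := (L : ℤ))).mpr (hxy i)
      simpa [sub_eq_add_neg, add_comm] using this)

end Box

section Characters

variable {d L : ℕ} {ξ : Fin d → ℝ}

/-- The phase `2π m·ξ`. -/
noncomputable def phase (ξ : Fin d → ℝ) (m : Fin d → ℤ) : ℝ := 2 * π * ∑ i, intVec m i * ξ i

theorem phase_add (m n : Fin d → ℤ) : phase ξ (m + n) = phase ξ m + phase ξ n := by
  simp only [phase, intVec_add, Pi.add_apply, add_mul, Finset.sum_add_distrib, mul_add]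

theorem phase_neg (m : Fin d → ℤ) : phase ξ (-m) = -phase ξ m := by
  simp [phase, intVec]

theorem phase_sub (m n : Fin d → ℤ) : phase ξ (m - n) = phase ξ m - phase ξ n := by
  rw [sub_eq_add_neg, phase_add, phase_neg, sub_eq_add_neg]

theorem phase_single (i : Fin d) (a : ℤ) : phase ξ (Pi.single i a) = 2 * π * (a * ξ i) := by
  unfold phase
  rw [Finset.sum_eq_single i]
  · simp [intVec]
  · intro j _ hj; simp [intVec, hj]
  · simp

theorem cosChar_eq (ξ : Fin d → ℝ) (m : Fin d → ℤ) : cosChar ξ m = Real.cos (phase ξ m) := rfl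

theorem phase_single_period (hξL : ∀ i, ∃ k : ℤ, (L : ℝ) * ξ i = k) (i : Fin d) :
    ∃ k : ℤ, phase ξ (Pi.single i (L : ℤ)) = k * (2 * π) := by
  obtain ⟨k, hk⟩ := hξL i
  refine ⟨k, ?_⟩
  rw [phase_single, Int.cast_natCast, hk]
  ring

theorem cosChar_add_single (hξL : ∀ i, ∃ k : ℤ, (L : ℝ) * ξ i = k) (m : Fin d → ℤ) (i : Fin d) :
    cosChar ξ (m + Pi.single i (L : ℤ)) = cosChar ξ m := by
  obtain ⟨k, hk⟩ := phase_single_period hξL i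
  rw [cosChar_eq, phase_add, hk, Real.cos_add_int_mul_two_pi, cosChar_eq]

theorem sin_phase_add_single (hξL : ∀ i, ∃ k : ℤ, (L : ℝ) * ξ i = k) (m : Fin d → ℤ) (i : Fin d) :
    Real.sin (phase ξ (m + Pi.single i (L : ℤ))) = Real.sin (phase ξ m) := by
  obtain ⟨k, hk⟩ := phase_single_period hξL i
  rw [phase_add, hk, Real.sin_add_int_mul_two_pi]

theorem sum_box_cosChar_eq_zero (hL : 1 ≤ L) (hξL : ∀ i, ∃ k : ℤ, (L : ℝ) * ξ i = k)
    (hξ : ¬ ∃ k : Fin d → ℤ, ξ = intVec k) : ∑ y ∈ box d L, cosChar ξ y = 0 := by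
  have : ∃ i, ∀ n : ℤ, ξ i ≠ n := by
    by_contra! h
    choose k hk using h
    exact hξ ⟨k, funext hk⟩
  obtain ⟨i, hi⟩ := this
  let E : (Fin d → ℤ) → ℂ := fun m => Complex.exp (phase ξ m * Complex.I)
  have hE : ∀ m n, E (m + n) = E m * E n := fun m n => by
    simp only [E]
    rw [phase_add, ← Complex.exp_add]
    push_cast
    ring_nf
  have hper : ∀ (m : Fin d → ℤ) (j : Fin d), E (m + Pi.single j (L : ℤ)) = E m := fun m j => by
    obtain ⟨k, hk⟩ := phase_single_period hξL j
    have : E (Pi.single j (L : ℤ)) = 1 := by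
      simp only [E]
      rw [hk, Complex.exp_eq_one_iff]
      exact ⟨k, by push_cast; ring⟩
    rw [hE, this, mul_one]
  have h1 := sum_box_add hL hper (Pi.single i 1)
  simp only [hE] at h1
  rw [← Finset.sum_mul] at h1
  have hne : E (Pi.single i 1) ≠ 1 := fun h => by
    simp only [E] at h
    rw [Complex.exp_eq_one_iff] at h
    obtain ⟨n, hn⟩ := h
    rw [phase_single] at hn
    apply hi n
    have h2 : (2 * π * Complex.I) ≠ 0 := Complex.two_pi_I_ne_zero
    have h3 : ((ξ i : ℝ) : ℂ) = ((n : ℝ) : ℂ) := by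
      apply mul_right_cancel₀ h2
      push_cast at hn ⊢
      linear_combination hn
    exact_mod_cast h3
  have h0 : ∑ y ∈ box d L, E y = 0 := by
    have : (∑ y ∈ box d L, E y) * (E (Pi.single i 1) - 1) = 0 := by linear_combination h1
    exact (mul_eq_zero.mp this).resolve_right (sub_ne_zero.mpr hne)
  have h2 := congrArg Complex.re h0
  rw [Complex.re_sum] at h2
  simp only [E, Complex.exp_ofReal_mul_I_re] at h2
  exact h2

/-- The autocorrelation of a cosine is proportional to that cosine. -/
theorem sum_box_cosChar_mul (hL : 1 ≤ L) (hξL : ∀ i, ∃ k : ℤ, (L : ℝ) * ξ i = k) (m : Fin d → ℤ) :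
    ∑ y ∈ box d L, cosChar ξ y * cosChar ξ (y + m) =
      cosChar ξ m * ∑ y ∈ box d L, cosChar ξ y ^ 2 := by
  have h0 : ∑ y ∈ box d L, cosChar ξ y * Real.sin (phase ξ y) = 0 := by
    have := sum_box_neg (h := fun y => cosChar ξ y * Real.sin (phase ξ y)) hL fun m i => by
      simp only [cosChar_add_single hξL, sin_phase_add_single hξL]
    simp only [cosChar_eq, phase_neg, Real.cos_neg, Real.sin_neg, mul_neg,
      Finset.sum_neg_distrib] at this
    simp only [cosChar_eq]
    linarith
  have h1 : ∀ y, cosChar ξ y * cosChar ξ (y + m) =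
      cosChar ξ m * cosChar ξ y ^ 2 - Real.sin (phase ξ m) * (cosChar ξ y * Real.sin (phase ξ y)) := by
    intro y
    simp only [cosChar_eq, phase_add, Real.cos_add]
    ring
  simp only [h1]
  rw [Finset.sum_sub_distrib, ← Finset.mul_sum, ← Finset.mul_sum, h0]
  ring

/-- The frequency `k / L`. -/
noncomputable def freq (L : ℕ) (k : Fin d → ℤ) : Fin d → ℝ := fun i => (k i : ℝ) / L

theorem freq_not_int {k : Fin d → ℤ} (hk : k ∈ box d L) (hk0 : k ≠ 0) :
    ¬ ∃ n : Fin d → ℤ, freq L k = intVec n := by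
  rintro ⟨n, hn⟩
  apply hk0
  funext i
  obtain ⟨h0, h1⟩ := mem_box.mp hk i
  have h2 := congrFun hn i
  simp only [freq, intVec] at h2
  have hL : (0 : ℝ) < L := by exact_mod_cast (lt_of_le_of_lt h0 h1)
  rw [div_eq_iff hL.ne'] at h2
  have h3 : k i = n i * L := by exact_mod_cast h2
  have h4 : (L : ℤ) ∣ k i := ⟨n i, by rw [h3]; ring⟩
  simpa using Int.eq_zero_of_dvd_of_nonneg_of_lt h0 h1 h4

theorem cosChar_freq_comm (k p : Fin d → ℤ) : cosChar (freq L k) p = cosChar (freq L p) k := by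
  unfold cosChar
  congr 2
  exact Finset.sum_congr rfl fun i _ => by simp only [freq, intVec]; ring

theorem sum_box_cosChar_freq (hL : 1 ≤ L) (p : Fin d → ℤ) :
    ∑ k ∈ box d L, cosChar (freq L k) p = if ∀ i, (L : ℤ) ∣ p i then (L : ℝ) ^ d else 0 := by
  have hL0 : (L : ℝ) ≠ 0 := by positivity
  simp only [fun k => cosChar_freq_comm (L := L) k p]
  split_ifs with h
  · choose n hn using h
    have : ∀ k, cosChar (freq L p) k = 1 := fun k => by
      rw [cosChar, Real.cos_eq_one_iff]
      refine ⟨∑ i, k i * n i, ?_⟩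
      rw [mul_comm]
      congr 1
      push_cast
      refine Finset.sum_congr rfl fun i _ => ?_
      simp only [intVec, freq, hn]
      push_cast
      field_simp
    simp [this, card_box]
  · refine sum_box_cosChar_eq_zero hL (fun i => ⟨p i, ?_⟩) ?_
    · simp only [freq]; field_simp
    · rintro ⟨n, hn⟩
      apply h
      intro i
      have h2 := congrFun hn i
      simp only [freq, intVec] at h2
      rw [div_eq_iff hL0] at h2
      have h3 : p i = n i * L := by exact_mod_cast h2
      exact ⟨n i, by rw [h3]; ring⟩

variable {χ : (Fin d → ℤ) → ℝ}

theorem sum_box_mul_sum_cosChar (hL : 1 ≤ L)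
    (hχ : ∀ (m : Fin d → ℤ) (i : Fin d), χ (m + Pi.single i (L : ℤ)) = χ m) (a : Fin d → ℤ) :
    ∑ y ∈ box d L, χ y * ∑ k ∈ box d L, cosChar (freq L k) (y - a) = (L : ℝ) ^ d * χ a := by
  simp only [sum_box_cosChar_freq hL]
  rw [Finset.sum_eq_single (modBox L a)]
  · rw [if_pos, periodic_modBox hχ, mul_comm]
    intro i
    rw [Pi.sub_apply, ← Int.dvd_neg, neg_sub]
    exact Int.dvd_self_sub_emod
  · intro y hy hya
    rw [if_neg, mul_zero]
    intro h
    apply hya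
    rw [← modBox_eq_of_mem hy]
    exact modBox_eq_iff.mpr h
  · exact fun h => absurd (modBox_mem hL a) h

/-- The spectral weight of a charge distribution at the frequency `k / L`. -/
noncomputable def spectralWeight (L : ℕ) (χ : (Fin d → ℤ) → ℝ) (k : Fin d → ℤ) : ℝ :=
  (((L : ℝ) ^ d)⁻¹ * ∑ y ∈ box d L, χ y * Real.cos (phase (freq L k) y)) ^ 2 +
    (((L : ℝ) ^ d)⁻¹ * ∑ y ∈ box d L, χ y * Real.sin (phase (freq L k) y)) ^ 2

theorem spectralWeight_nonneg (k : Fin d → ℤ) : 0 ≤ spectralWeight L χ k := by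
  unfold spectralWeight; positivity

theorem spectralWeight_zero (hχ0 : ∑ y ∈ box d L, χ y = 0) : spectralWeight L χ 0 = 0 := by
  have : ∀ y, phase (freq L (0 : Fin d → ℤ)) y = 0 := fun y => by simp [phase, freq]
  simp [spectralWeight, this, hχ0]

theorem spectralWeight_eq (k : Fin d → ℤ) : spectralWeight L χ k =
    ((L : ℝ) ^ d)⁻¹ ^ 2 * ∑ y ∈ box d L, ∑ y' ∈ box d L,
      χ y * χ y' * cosChar (freq L k) (y' - y) := by
  simp only [cosChar_eq, phase_sub, Real.cos_sub, mul_add, Finset.sum_add_distrib, spectralWeight,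
    mul_pow]
  simp only [sq (Finset.sum _ _), Finset.sum_mul_sum]
  congr 2 <;> exact Finset.sum_congr rfl fun y _ => Finset.sum_congr rfl fun y' _ => by ring

theorem autocorrelation_eq (hL : 1 ≤ L)
    (hχ : ∀ (m : Fin d → ℤ) (i : Fin d), χ (m + Pi.single i (L : ℤ)) = χ m) (m : Fin d → ℤ) :
    ((L : ℝ) ^ d)⁻¹ * ∑ y ∈ box d L, χ y * χ (y + m) =
      ∑ k ∈ box d L, spectralWeight L χ k * cosChar (freq L k) m := by
  have hL0 : (L : ℝ) ^ d ≠ 0 := by positivity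
  have h1 : ∀ k, spectralWeight L χ k * cosChar (freq L k) m =
      ∑ y ∈ box d L, ∑ y' ∈ box d L, ((L : ℝ) ^ d)⁻¹ ^ 2 / 2 * χ y * χ y' *
        (cosChar (freq L k) (y' - (y - m)) + cosChar (freq L k) (y' - (y + m))) := by
    intro k
    rw [spectralWeight_eq, Finset.mul_sum, Finset.sum_mul]
    refine Finset.sum_congr rfl fun y _ => ?_
    rw [Finset.mul_sum, Finset.sum_mul]
    refine Finset.sum_congr rfl fun y' _ => ?_
    have e1 : y' - (y - m) = (y' - y) + m := by abel
    have e2 : y' - (y + m) = (y' - y) - m := by abel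
    rw [e1, e2]
    simp only [cosChar_eq, phase_add, phase_sub (y' - y), Real.cos_add, Real.cos_sub _ (phase _ m)]
    ring
  have h2 : ∑ y ∈ box d L, χ y * χ (y - m) = ∑ y ∈ box d L, χ y * χ (y + m) := by
    have := sum_box_add (h := fun y => χ y * χ (y - m)) hL (fun n i => by
      have e : n + Pi.single i (L : ℤ) - m = (n - m) + Pi.single i (L : ℤ) := by abel
      simp only [e, hχ]) m
    rw [← this]
    refine Finset.sum_congr rfl fun y _ => ?_
    simp only [add_sub_cancel_right]
    ring
  have h3 : ∑ k ∈ box d L, spectralWeight L χ k * cosChar (freq L k) m =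
      ∑ y ∈ box d L, ((L : ℝ) ^ d)⁻¹ ^ 2 / 2 * χ y *
        ((∑ y' ∈ box d L, χ y' * ∑ k ∈ box d L, cosChar (freq L k) (y' - (y - m))) +
        ∑ y' ∈ box d L, χ y' * ∑ k ∈ box d L, cosChar (freq L k) (y' - (y + m))) := by
    simp only [h1]
    rw [Finset.sum_comm]
    refine Finset.sum_congr rfl fun y _ => ?_
    rw [Finset.sum_comm, ← Finset.sum_add_distrib, Finset.mul_sum]
    refine Finset.sum_congr rfl fun y' _ => ?_
    rw [← mul_add, ← Finset.sum_add_distrib, ← Finset.mul_sum]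
    ring
  rw [h3]
  simp only [sum_box_mul_sum_cosChar hL hχ]
  have h4 : ∀ y, ((L : ℝ) ^ d)⁻¹ ^ 2 / 2 * χ y * ((L : ℝ) ^ d * χ (y - m) + (L : ℝ) ^ d * χ (y + m)) =
      ((L : ℝ) ^ d)⁻¹ / 2 * (χ y * χ (y - m)) + ((L : ℝ) ^ d)⁻¹ / 2 * (χ y * χ (y + m)) := by
    intro y
    field_simp
  simp only [h4]
  rw [Finset.sum_add_distrib, ← Finset.mul_sum, ← Finset.mul_sum, h2]
  ring

end Characters

section Energy

variable {d L : ℕ} {A B : Matrix (Fin d) (Fin d) ℝ} {μ : Measure ℝ} {f : (Fin d → ℝ) → ℝ}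
  {χ : (Fin d → ℤ) → ℝ}

theorem ewald_eq_sum_dampedSum (hd : 1 ≤ d) (hBA : B.transpose * A = 1)
    (hμf : ∀ x : Fin d → ℝ, x ≠ 0 →
      IntegrableOn (fun t : ℝ => Real.exp (-sqNorm x * t)) (Set.Ici 0) μ)
    (hf : ∀ x : Fin d → ℝ, x ≠ 0 → f x = ∫ t in Set.Ici 0, Real.exp (-sqNorm x * t) ∂μ)
    (hL : 1 ≤ L)
    (hχ : ∀ (m : Fin d → ℤ) (i : Fin d), χ (m + Pi.single i (L : ℤ)) = χ m)
    {ι : Type*} (S : Finset ι) (w : ι → ℝ) (ξ : ι → Fin d → ℝ)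
    (hS : ∀ m, ((L : ℝ) ^ d)⁻¹ * ∑ y ∈ box d L, χ y * χ (y + m) =
      ∑ k ∈ S, w k * cosChar (ξ k) m) {η : ℝ} (hη : 0 < η) :
    (2 * (L : ℝ) ^ d)⁻¹ * ∑ y ∈ box d L, ∑' m : {m : Fin d → ℤ // m ≠ 0},
      χ y * χ (y + m.1) * f (A.mulVec (intVec m.1)) *
        Real.exp (-η * sqNorm (A.mulVec (intVec m.1))) =
      1 / 2 * ∑ k ∈ S, w k * dampedSum A f (ξ k) η := by
  obtain ⟨hm, hs⟩ := summable_mul_exp_neg hd hBA hμf hf hη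
  set g : {m : Fin d → ℤ // m ≠ 0} → ℝ := fun m =>
    f (A.mulVec (intVec m.1)) * Real.exp (-(η * sqNorm (A.mulVec (intVec m.1)))) with hg
  have hbound : ∀ x, |χ x| ≤ ∑ y ∈ box d L, |χ y| := fun x => by
    rw [← periodic_modBox hχ x]
    exact Finset.single_le_sum (f := fun y => |χ y|) (fun _ _ => abs_nonneg _) (modBox_mem hL x)
  have hsum : ∀ a : {m : Fin d → ℤ // m ≠ 0} → ℝ, ∀ C, (∀ m, |a m| ≤ C) →
      Summable fun m => a m * g m := fun a C ha => by
    refine Summable.of_norm_bounded (hs.mul_left C) fun m => ?_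
    have hg0 : 0 ≤ g m := mul_nonneg (hm m).2 (Real.exp_pos _).le
    rw [norm_mul, Real.norm_eq_abs, Real.norm_eq_abs, abs_of_nonneg hg0]
    exact mul_le_mul_of_nonneg_right (ha m) hg0
  have e1 : ∀ y (m : {m : Fin d → ℤ // m ≠ 0}), χ y * χ (y + m.1) * f (A.mulVec (intVec m.1)) *
        Real.exp (-η * sqNorm (A.mulVec (intVec m.1))) = χ y * χ (y + m.1) * g m := fun y m => by
    rw [hg, neg_mul, mul_assoc]
  simp only [e1, dampedSum]
  rw [← Summable.tsum_finsetSum fun y _ => hsum (fun m => χ y * χ (y + m.1))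
    (|χ y| * ∑ y ∈ box d L, |χ y|) fun m => by
      rw [abs_mul]; exact mul_le_mul_of_nonneg_left (hbound _) (abs_nonneg _)]
  simp only [← tsum_mul_left]
  rw [← Summable.tsum_finsetSum fun k _ =>
    (hsum (fun m => cosChar (ξ k) m.1) 1 fun m => abs_cosChar_le_one _ _).mul_left (w k),
    ← tsum_mul_left]
  refine tsum_congr fun m => ?_
  have := hS m.1
  simp only [← mul_assoc (w _)]
  rw [← Finset.sum_mul, ← Finset.sum_mul, ← this, mul_inv]
  ring

end Energy

/-- Nonsummable case: if `z₀ ∉ Bℤ^d` minimizes the translated theta function of the dual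
lattice for every `α > 0` and `Nz₀ ∈ Bℤ^d` for some `N ≥ 2`, then for `f ∈ 𝓕` the
configuration `φ*(m) = c·cos(2π(Am)·z₀)` is `N`-periodic, normalized and charge neutral,
its Ewald energy exists, and it minimizes the Ewald energy among all periodic normalized
charge-neutral configurations. -/
theorem optimal_charge_cosine_ewald (d N : ℕ) (hd : 1 ≤ d) (hN : 2 ≤ N)
    (A : Matrix (Fin d) (Fin d) ℝ) (hA : IsUnit A.det) (hdet : |A.det| = 1)
    (B : Matrix (Fin d) (Fin d) ℝ) (hB : B = A⁻¹.transpose)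
    (μ : Measure ℝ) (f : (Fin d → ℝ) → ℝ)
    (hμf : ∀ x : Fin d → ℝ, x ≠ 0 →
      IntegrableOn (fun t : ℝ => Real.exp (-(∑ i, x i ^ 2) * t)) (Set.Ici 0) μ)
    (hf : ∀ x : Fin d → ℝ, x ≠ 0 →
      f x = ∫ t in Set.Ici 0, Real.exp (-(∑ i, x i ^ 2) * t) ∂μ)
    (z₀ : Fin d → ℝ)
    (hz₀ : ∀ α : ℝ, 0 < α → ∀ z : Fin d → ℝ,
      (∑' n : Fin d → ℤ, Real.exp (-π * α * ∑ i, (B.mulVec (fun j => (n j : ℝ)) i + z₀ i) ^ 2)) ≤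
        ∑' n : Fin d → ℤ, Real.exp (-π * α * ∑ i, (B.mulVec (fun j => (n j : ℝ)) i + z i) ^ 2))
    (hz₀notin : ¬ ∃ k : Fin d → ℤ, z₀ = B.mulVec fun j => (k j : ℝ))
    (hz₀N : ∃ k : Fin d → ℤ, (N : ℝ) • z₀ = B.mulVec fun j => (k j : ℝ))
    (Ew : ℕ → ((Fin d → ℤ) → ℝ) → ℝ → Prop)
    (hEw : ∀ (L : ℕ) (χ : (Fin d → ℤ) → ℝ) (e : ℝ),
      Ew L χ e ↔ Tendsto (fun η : ℝ =>
        (2 * (L : ℝ) ^ d)⁻¹ *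
          ∑ y ∈ Fintype.piFinset (fun _ : Fin d => Finset.Ico (0 : ℤ) (L : ℤ)),
            ∑' m : {m : Fin d → ℤ // m ≠ 0},
              χ y * χ (y + m.1) * f (A.mulVec fun j => (m.1 j : ℝ)) *
                Real.exp (-η * ∑ i, (A.mulVec (fun j => (m.1 j : ℝ)) i) ^ 2))
        (𝓝[>] (0 : ℝ)) (𝓝 e)) :
    ∃ c : ℝ, 0 < c ∧
      ∀ φstar : (Fin d → ℤ) → ℝ,
        (∀ m : Fin d → ℤ,
          φstar m = c * Real.cos (2 * π * ∑ i, A.mulVec (fun j => (m j : ℝ)) i * z₀ i)) →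
        (∀ (m : Fin d → ℤ) (i : Fin d), φstar (m + Pi.single i (N : ℤ)) = φstar m) ∧
        ((N : ℝ) ^ d)⁻¹ *
          (∑ y ∈ Fintype.piFinset (fun _ : Fin d => Finset.Ico (0 : ℤ) (N : ℤ)), φstar y ^ 2) = 1 ∧
        (∑ y ∈ Fintype.piFinset (fun _ : Fin d => Finset.Ico (0 : ℤ) (N : ℤ)), φstar y) = 0 ∧
        ∃ Estar : ℝ, Ew N φstar Estar ∧
          ∀ (M : ℕ), 1 ≤ M → ∀ ψ : (Fin d → ℤ) → ℝ,
            (∀ (m : Fin d → ℤ) (i : Fin d), ψ (m + Pi.single i (M : ℤ)) = ψ m) →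
            ((M : ℝ) ^ d)⁻¹ *
              (∑ y ∈ Fintype.piFinset (fun _ : Fin d => Finset.Ico (0 : ℤ) (M : ℤ)), ψ y ^ 2) = 1 →
            (∑ y ∈ Fintype.piFinset (fun _ : Fin d => Finset.Ico (0 : ℤ) (M : ℤ)), ψ y) = 0 →
            ∃ Epsi : ℝ, Ew M ψ Epsi ∧ Estar ≤ Epsi := by
  subst hB
  have hBA : (A⁻¹.transpose).transpose * A = 1 := by
    rw [Matrix.transpose_transpose, Matrix.nonsing_inv_mul A hA]
  have hAB : A.transpose * A⁻¹.transpose = 1 := by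
    rw [← Matrix.transpose_mul, Matrix.nonsing_inv_mul A hA, Matrix.transpose_one]
  have hBA' : A⁻¹.transpose * A.transpose = 1 := by
    rw [← Matrix.transpose_mul, Matrix.mul_nonsing_inv A hA, Matrix.transpose_one]
  have hBdet : |(A⁻¹.transpose).det| = 1 := by
    rw [Matrix.det_transpose, Matrix.det_nonsing_inv, Ring.inverse_eq_inv', abs_inv, hdet, inv_one]
  set B := A⁻¹.transpose
  set ξ₀ : Fin d → ℝ := A.transpose.mulVec z₀ with hξ₀_def
  have hBξ₀ : B.mulVec ξ₀ = z₀ := by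
    rw [hξ₀_def, Matrix.mulVec_mulVec, hBA', Matrix.one_mulVec]
  have hξ₀ : ¬ ∃ k : Fin d → ℤ, ξ₀ = intVec k := fun ⟨k, hk⟩ =>
    hz₀notin ⟨k, by rw [← hBξ₀, hk]; rfl⟩
  have hξ₀N : ∀ i, ∃ k : ℤ, (N : ℝ) * ξ₀ i = k := by
    obtain ⟨k, hk⟩ := hz₀N
    have h := congrArg A.transpose.mulVec hk
    rw [Matrix.mulVec_smul, Matrix.mulVec_mulVec, hAB, Matrix.one_mulVec] at h
    exact fun i => ⟨k i, congrFun h i⟩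
  have hphase : ∀ m : Fin d → ℤ,
      Real.cos (2 * π * ∑ i, A.mulVec (fun j => (m j : ℝ)) i * z₀ i) = cosChar ξ₀ m := fun m => by
    rw [cosChar, sum_intVec_mul_eq hAB (intVec m) ξ₀, hBξ₀]
    rfl
  have hmin : ∀ α : ℝ, 0 < α → ∀ ξ : Fin d → ℝ,
      ∑' n : Fin d → ℤ, Real.exp (-(π * α * sqNorm (B.mulVec (intVec n + ξ₀)))) ≤
        ∑' n : Fin d → ℤ, Real.exp (-(π * α * sqNorm (B.mulVec (intVec n + ξ)))) := by
    intro α hα ξ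
    have h := hz₀ α hα (B.mulVec ξ)
    rw [← hBξ₀] at h
    simp only [neg_mul] at h
    simp only [Matrix.mulVec_add]
    exact h
  have hN1 : 1 ≤ N := by omega
  have hNd : (0 : ℝ) < (N : ℝ) ^ d := by positivity
  set q : ℝ := ((N : ℝ) ^ d)⁻¹ * ∑ y ∈ box d N, cosChar ξ₀ y ^ 2 with hq_def
  have hq : 0 < q := by
    refine mul_pos (inv_pos.mpr hNd) (Finset.sum_pos' (fun _ _ => sq_nonneg _) ⟨0, ?_, ?_⟩)
    · exact mem_box.mpr fun i => ⟨le_rfl, Int.natCast_pos.mpr hN1⟩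
    · simp [cosChar, intVec]
  have hcq : (√q)⁻¹ ^ 2 * q = 1 := by
    rw [inv_pow, Real.sq_sqrt hq.le, inv_mul_cancel₀ hq.ne']
  refine ⟨(√q)⁻¹, by positivity, fun φ hφ => ?_⟩
  simp only [hphase] at hφ
  have hφper : ∀ (m : Fin d → ℤ) (i : Fin d), φ (m + Pi.single i (N : ℤ)) = φ m := fun m i => by
    rw [hφ, hφ, cosChar_add_single hξ₀N]
  obtain ⟨e₀, he₀⟩ := exists_tendsto_dampedSum hd hAB hBdet hμf hf hξ₀
  refine ⟨hφper, ?_, ?_, 1 / 2 * e₀, ?_, ?_⟩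
  · change ((N : ℝ) ^ d)⁻¹ * ∑ y ∈ box d N, φ y ^ 2 = 1
    simp only [hφ, mul_pow]
    rw [← Finset.mul_sum, mul_left_comm, ← hq_def, hcq]
  · change ∑ y ∈ box d N, φ y = 0
    simp only [hφ]
    rw [← Finset.mul_sum, sum_box_cosChar_eq_zero hN1 hξ₀N hξ₀, mul_zero]
  · rw [hEw]
    have hS : ∀ m, ((N : ℝ) ^ d)⁻¹ * ∑ y ∈ box d N, φ y * φ (y + m) =
        ∑ _k ∈ ({()} : Finset Unit), 1 * cosChar ξ₀ m := fun m => by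
      have h : ∀ y, φ y * φ (y + m) = (√q)⁻¹ ^ 2 * (cosChar ξ₀ y * cosChar ξ₀ (y + m)) :=
        fun y => by rw [hφ, hφ]; ring
      simp only [h]
      rw [← Finset.mul_sum, sum_box_cosChar_mul hN1 hξ₀N, Finset.sum_singleton, one_mul]
      linear_combination cosChar ξ₀ m * hcq
    refine (he₀.const_mul (1 / 2)).congr' ?_
    filter_upwards [self_mem_nhdsWithin] with η hη
    refine Eq.trans ?_ (ewald_eq_sum_dampedSum hd hBA hμf hf hN1 hφper {()} (fun _ => 1)
      (fun _ => ξ₀) hS hη).symm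
    simp
  · intro M hM ψ hψper hψnorm hψ0
    have hfreq : ∀ k ∈ (box d M).erase 0, ¬ ∃ n : Fin d → ℤ, freq M k = intVec n := fun k hk =>
      freq_not_int (Finset.mem_of_mem_erase hk) (Finset.ne_of_mem_erase hk)
    have hauto : ∀ m, ((M : ℝ) ^ d)⁻¹ * ∑ y ∈ box d M, ψ y * ψ (y + m) =
        ∑ k ∈ (box d M).erase 0, spectralWeight M ψ k * cosChar (freq M k) m := fun m => by
      rw [autocorrelation_eq hM hψper, Finset.sum_erase]
      rw [spectralWeight_zero hψ0, zero_mul]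
    have hw : ∑ k ∈ (box d M).erase 0, spectralWeight M ψ k = 1 := by
      have h := hauto 0
      simp only [cosChar_zero, mul_one, add_zero, ← sq] at h
      exact h.symm.trans hψnorm
    choose! e he using fun k hk => exists_tendsto_dampedSum hd hAB hBdet hμf hf (hfreq k hk)
    refine ⟨1 / 2 * ∑ k ∈ (box d M).erase 0, spectralWeight M ψ k * e k, ?_, ?_⟩
    · rw [hEw]
      refine ((tendsto_finsetSum _ fun k hk =>
        (he k hk).const_mul (spectralWeight M ψ k)).const_mul (1 / 2)).congr' ?_
      filter_upwards [self_mem_nhdsWithin] with η hη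
      exact (ewald_eq_sum_dampedSum hd hBA hμf hf hM hψper _ (spectralWeight M ψ) (freq M)
        hauto hη).symm
    · have hle : ∀ k ∈ (box d M).erase 0, e₀ ≤ e k := fun k hk =>
        le_of_tendsto_of_tendsto he₀ (he k hk) (by
          filter_upwards [self_mem_nhdsWithin] with η hη
          exact dampedSum_le hd hAB hBdet hμf hf hmin hξ₀ (hfreq k hk) hη)
      refine mul_le_mul_of_nonneg_left ?_ (by norm_num)
      calc e₀ = ∑ k ∈ (box d M).erase 0, spectralWeight M ψ k * e₀ := by
            rw [← Finset.sum_mul, hw, one_mul]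
        _ ≤ _ := Finset.sum_le_sum fun k hk =>
            mul_le_mul_of_nonneg_left (hle k hk) (spectralWeight_nonneg k)
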